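/- Let a, b, c be positive integers such that a + b + c − 1 is prime and c > ab − a − b + 1. Then for every order ideal I ∈ J(𝐚×𝐛×𝐜), the cardinality of the rowmotion orbit of I, i.e., the least m > 0 with Row^m(I) = I, is a multiple of a + b + c − 1. -/

import Mathlib

/-- Rowmotion on order ideals (lower sets) of a poset `P`: `I` is sent to the
order ideal generated by the minimal elements of the complement of `I`. -/
def rowmo {P : Type*} [PartialOrder P] (I : Set P) : Set P :=
  {x | ∃ m, Minimal (fun y => y ∉ I) m ∧ x ≤ m}


/-- Abstract one-step data: `h` is the height function of a (1-indexed, padded) plane partition,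
`h'` the height function of its promotion. -/
structure StepData (a b c : ℕ) (h h' : ℕ → ℕ → ℕ) : Prop where
  row0 : ∀ j, h 0 j = c
  col0 : ∀ i, h i 0 = c
  bot' : ∀ i j, a < i → 0 < j → h' i j = 0
  right' : ∀ i j, b < j → 0 < i → h' i j = 0
  le : ∀ i j, h i j ≤ c
  le' : ∀ i j, h' i j ≤ c
  mono1 : ∀ i j, i < a → j < b → h (i+1) (j+1) ≤ h i (j+1)
  mono2 : ∀ i j, i < a → j < b → h (i+1) (j+1) ≤ h (i+1) j
  step : ∀ i j, i < a → j < b →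
    ((h' (i+2) (j+1) < h (i+1) (j+1) ∧ h' (i+1) (j+2) < h (i+1) (j+1)
        ∧ h' (i+1) (j+1) + 1 = h (i+1) (j+1)) ∨
     (max (h' (i+2) (j+1)) (h' (i+1) (j+2)) = h (i+1) (j+1) ∧
        h' (i+1) (j+1) = min (h i (j+1)) (h (i+1) j)))

/-- `v` occurs as an entry of the increasing tableau of `h`. -/
def TabContent (a b : ℕ) (h : ℕ → ℕ → ℕ) (v : ℕ) : Prop :=
  ∃ i j, i < a ∧ j < b ∧ h (i+1) (j+1) + (a - 1 - i) + (b - 1 - j) = v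

namespace StepData
variable {a b c : ℕ} {h h' : ℕ → ℕ → ℕ}

lemma fwd (S : StepData a b c h h') {v : ℕ} (hv : TabContent a b h (v+1)) : TabContent a b h' v := by
  obtain ⟨i, j, hi, hj, e⟩ := hv
  rcases S.step i j hi hj with ⟨_, _, h3⟩ | ⟨h1, h2⟩
  · exact ⟨i, j, hi, hj, by omega⟩
  · have b1 := S.bot' (i+2) (j+1)
    have b2 := S.right' (i+1) (j+2)
    by_cases hA : i + 1 < a ∧ h' (i+2) (j+1) = h (i+1) (j+1)
    · exact ⟨i+1, j, hA.1, hj, by have := hA.2; have : h' (i+1+1) (j+1) = h (i+1) (j+1) := this; omega⟩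
    · by_cases hB : j + 1 < b
      · refine ⟨i, j+1, hi, hB, ?_⟩
        have : h' (i+1) (j+2) = h (i+1) (j+1) := by omega
        have : h' (i+1) (j+1+1) = h (i+1) (j+1) := this
        omega
      · exfalso; omega

lemma bwd (S : StepData a b c h h') {v : ℕ} (hv : TabContent a b h' v) (hq : v + 1 < a + b + c - 1) :
    TabContent a b h (v+1) := by
  obtain ⟨i, j, hi, hj, e⟩ := hv
  rcases S.step i j hi hj with ⟨_, _, h3⟩ | ⟨h1, h2⟩
  · exact ⟨i, j, hi, hj, by omega⟩
  · have b1 := S.row0 (j+1)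
    have b2 := S.col0 (i+1)
    have l1 := S.le i (j+1)
    have l2 := S.le (i+1) j
    rcases i with _ | i <;> rcases j with _ | j
    · exfalso; simp only [zero_add] at *; omega
    · refine ⟨0, j, hi, by omega, ?_⟩
      simp only [zero_add] at *; omega
    · refine ⟨i, 0, by omega, hj, ?_⟩
      simp only [zero_add] at *; omega
    · rcases le_total (h (i+1) (j+1+1)) (h (i+1+1) (j+1)) with hle | hle
      · exact ⟨i, j+1, by omega, hj, by omega⟩
      · exact ⟨i+1, j, hi, by omega, by omega⟩

lemma slide_up (S : StepData a b c h h') : ∀ n i j, i + j = n → i < a → j < b →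
    max (h' (i+2) (j+1)) (h' (i+1) (j+2)) = h (i+1) (j+1) → h' 1 1 = c := by
  intro n
  induction n with
  | zero =>
    intro i j hn hi hj hm
    obtain rfl : i = 0 := by omega
    obtain rfl : j = 0 := by omega
    have b1 := S.row0 1
    have b2 := S.col0 1
    rcases S.step 0 0 hi hj with h3 | ⟨h1, h2⟩ <;> simp only [zero_add] at * <;> omega
  | succ n ih =>
    intro i j hn hi hj hm
    have l1 := S.le i (j+1)
    have l2 := S.le (i+1) j
    rcases S.step i j hi hj with h3 | ⟨h1, h2⟩
    · omega
    by_cases hc : 0 < i ∧ h' (i+1) (j+1) = h i (j+1)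
    · obtain ⟨i, rfl⟩ : ∃ k, i = k + 1 := ⟨i - 1, by omega⟩
      refine ih i j (by omega) (by omega) hj ?_
      have e : h' (i+2) (j+1) = h (i+1) (j+1) := hc.2
      rcases S.step i j (by omega) hj with h3 | h3
      · omega
      · exact h3.1
    · have hj0 : 0 < j ∧ h' (i+1) (j+1) = h (i+1) j := by
        have b1 := S.row0 (j+1)
        have b2 := S.col0 (i+1)
        by_cases hi0 : i = 0
        · subst hi0; omega
        · have : h' (i+1) (j+1) ≠ h i (j+1) := fun e => hc ⟨by omega, e⟩
          refine ⟨?_, by omega⟩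
          by_contra h0
          obtain rfl : j = 0 := by omega
          simp only [zero_add] at *
          omega
      obtain ⟨j, rfl⟩ : ∃ k, j = k + 1 := ⟨j - 1, by omega⟩
      refine ih i j (by omega) hi (by omega) ?_
      have e : h' (i+1) (j+2) = h (i+1) (j+1) := hj0.2
      rcases S.step i j hi (by omega) with h3 | h3
      · omega
      · exact h3.1

lemma slide_down (S : StepData a b c h h') : ∀ n i j, (a - i) + (b - j) = n → i < a → j < b →
    max (h' (i+2) (j+1)) (h' (i+1) (j+2)) = h (i+1) (j+1) → h a b = 0 := by
  intro n
  induction n using Nat.strong_induction_on with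
  | _ n ih =>
    intro i j hn hi hj hm
    have b1 := S.bot' (i+2) (j+1)
    have b2 := S.right' (i+1) (j+2)
    by_cases hA : i + 1 < a ∧ h' (i+2) (j+1) = h (i+1) (j+1)
    · refine ih _ ?_ (i+1) j rfl hA.1 hj ?_
      · omega
      · rcases S.step (i+1) j hA.1 hj with h3 | h3
        · have := S.mono1 (i+1) j hA.1 hj
          have := hA.2
          have e : h' (i+1+1) (j+1) = h (i+1) (j+1) := this
          omega
        · exact h3.1
    · by_cases hB : j + 1 < b
      · refine ih _ ?_ i (j+1) rfl hi hB ?_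
        · omega
        · rcases S.step i (j+1) hi hB with h3 | h3
          · have := S.mono2 i (j+1) hi hB
            have : h' (i+1) (j+2) = h (i+1) (j+1) := by omega
            have e : h' (i+1) (j+1+1) = h (i+1) (j+1) := this
            omega
          · exact h3.1
      · have e1 : ¬ (i + 1 < a) := by
          intro h0
          have : h' (i+2) (j+1) ≠ h (i+1) (j+1) := fun e => hA ⟨h0, e⟩
          omega
        obtain rfl : a = i + 1 := by omega
        obtain rfl : b = j + 1 := by omega
        omega

lemma top (S : StepData a b c h h') (ha : 0 < a) (hb : 0 < b) :
    TabContent a b h' (a + b + c - 1 - 1) ↔ TabContent a b h 0 := by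
  constructor
  · rintro ⟨i, j, hi, hj, e⟩
    have l1 := S.le' (i+1) (j+1)
    obtain rfl : i = 0 := by omega
    obtain rfl : j = 0 := by omega
    have l2 := S.le (0+1) (0+1)
    have : h a b = 0 := by
      rcases S.step 0 0 hi hj with h3 | h3
      · omega
      · exact S.slide_down _ 0 0 rfl hi hj h3.1
    refine ⟨a-1, b-1, by omega, by omega, ?_⟩
    rw [Nat.sub_add_cancel ha, Nat.sub_add_cancel hb]; omega
  · rintro ⟨i, j, hi, hj, e⟩
    obtain ⟨rfl⟩ : a = i + 1 := by omega
    obtain ⟨rfl⟩ : b = j + 1 := by omega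
    have : h' 1 1 = c := by
      refine S.slide_up _ i j rfl hi hj ?_
      rcases S.step i j hi hj with h3 | h3
      · omega
      · exact h3.1
    exact ⟨0, 0, by omega, by omega, by simp only [zero_add]; omega⟩

end StepData

/-- The combinatorial core: a sequence of height functions has a `q`-periodic, nonconstant
bit sequence. -/
lemma core (a b c : ℕ) (ha : 0 < a) (hb : 0 < b) (hab : a * b < a + b + c - 1)
    (h : ℕ → ℕ → ℕ → ℕ) (S : ∀ t, StepData a b c (h t) (h (t+1))) (B : ℕ → Prop)
    (hB : ∀ t, B t ↔ h t a b = 0) :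
    (∀ t, B (t + (a + b + c - 1)) ↔ B t) ∧ (∃ t, B t) ∧ (∃ t, ¬ B t) := by
  have hB0 : ∀ t, B t ↔ TabContent a b (h t) 0 := by
    intro t
    rw [hB]
    constructor
    · intro h0
      refine ⟨a-1, b-1, by omega, by omega, ?_⟩
      rw [Nat.sub_add_cancel ha, Nat.sub_add_cancel hb]; omega
    · rintro ⟨i, j, hi, hj, e⟩
      obtain ⟨rfl⟩ : a = i + 1 := by omega
      obtain ⟨rfl⟩ : b = j + 1 := by omega
      omega
  have hC : ∀ v t, v < a + b + c - 1 → (TabContent a b (h t) v ↔ B (t + v)) := by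
    intro v
    induction v with
    | zero => intro t _; exact (hB0 t).symm
    | succ v ih =>
      intro t hv
      rw [show t + (v+1) = (t+1) + v by ring, ← ih (t+1) (by omega)]
      exact ⟨(S t).fwd, fun H => (S t).bwd H hv⟩
  refine ⟨?_, ?_, ?_⟩
  · intro t
    rw [hB0 t, ← (S t).top ha hb, hC _ _ (by omega)]
    rw [show t + (a+b+c-1) = t + 1 + (a+b+c-1-1) by omega]
  · have l := (S 0).le (0+1) (0+1)
    exact ⟨_, (hC (h 0 (0+1) (0+1) + (a-1-0) + (b-1-0)) 0 (by omega)).1 ⟨0, 0, ha, hb, rfl⟩⟩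
  · by_contra hne
    push Not at hne
    have hsub : Finset.range (a+b+c-1) ⊆ ((Finset.range a) ×ˢ (Finset.range b)).image
        (fun p => h 0 (p.1+1) (p.2+1) + (a-1-p.1) + (b-1-p.2)) := by
      intro v hv
      obtain ⟨i, j, hi, hj, e⟩ := (hC v 0 (Finset.mem_range.1 hv)).2 (hne _)
      exact Finset.mem_image.2 ⟨(i, j), by simp [hi, hj], e⟩
    have := (Finset.card_le_card hsub).trans Finset.card_image_le
    simp at this
    omega

/-- Membership with natural number coordinates. -/
def NMem {a b c : ℕ} (I : Set (Fin a × Fin b × Fin c)) (i j k : ℕ) : Prop :=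
  ∃ (hi : i < a) (hj : j < b) (hk : k < c), ((⟨i, hi⟩, ⟨j, hj⟩, ⟨k, hk⟩) : Fin a × Fin b × Fin c) ∈ I

lemma rowmo_lower {P : Type*} [PartialOrder P] (I : Set P) : IsLowerSet (rowmo I) := by
  rintro x y hyx ⟨m, hm, hx⟩
  exact ⟨m, hm, hyx.trans hx⟩

section
variable {a b c : ℕ} {I : Set (Fin a × Fin b × Fin c)}

lemma NMem.mono (hI : IsLowerSet I) {i j k i' j' k' : ℕ} (h : NMem I i j k)
    (hi : i' ≤ i) (hj : j' ≤ j) (hk : k' ≤ k) : NMem I i' j' k' := by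
  obtain ⟨h1, h2, h3, hm⟩ := h
  exact ⟨by omega, by omega, by omega, hI (by simp [Prod.le_def, hi, hj, hk]) hm⟩

lemma NMem.below {i j k i' j' k' : ℕ} (h : NMem (rowmo I) i j k)
    (hi : i' ≤ i) (hj : j' ≤ j) (hk : k' ≤ k) (hlt : i' + j' + k' < i + j + k) :
    NMem I i' j' k' := by
  obtain ⟨h1, h2, h3, ⟨m1, m2, m3⟩, hm, hle⟩ := h
  simp only [Prod.le_def, Fin.le_def] at hle
  refine ⟨by omega, by omega, by omega, ?_⟩
  by_contra hn
  have := hm.2 hn (by simp only [Prod.le_def, Fin.le_def]; omega)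
  simp only [Prod.le_def, Fin.le_def] at this
  omega

lemma NMem.row (hI : IsLowerSet I) {i j k : ℕ} (hi : i < a) (hj : j < b) (hk : k < c) :
    NMem (rowmo I) i j k ↔
      (¬ NMem I i j k ∧ (i = 0 ∨ NMem I (i-1) j k) ∧ (j = 0 ∨ NMem I i (j-1) k) ∧
        (k = 0 ∨ NMem I i j (k-1))) ∨
      NMem (rowmo I) (i+1) j k ∨ NMem (rowmo I) i (j+1) k ∨ NMem (rowmo I) i j (k+1) := by
  constructor
  · intro h
    have hb := @NMem.below a b c I i j k
    by_cases hx : NMem I i j k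
    · right
      obtain ⟨h1, h2, h3, ⟨m1, m2, m3⟩, hm, hle⟩ := h
      have hne : ¬ (m1.1 = i ∧ m2.1 = j ∧ m3.1 = k) := by
        rintro ⟨rfl, rfl, rfl⟩
        obtain ⟨_, _, _, hx⟩ := hx
        exact hm.1 hx
      simp only [Prod.le_def, Fin.le_def] at hle
      have := m1.2
      have := m2.2
      have := m3.2
      by_cases e1 : i = m1.1
      · by_cases e2 : j = m2.1
        · right; right
          refine ⟨hi, hj, by omega, ⟨m1, m2, m3⟩, hm, ?_⟩
          simp only [Prod.le_def, Fin.le_def]; omega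
        · right; left
          refine ⟨hi, by omega, hk, ⟨m1, m2, m3⟩, hm, ?_⟩
          simp only [Prod.le_def, Fin.le_def]; omega
      · left
        refine ⟨by omega, hj, hk, ⟨m1, m2, m3⟩, hm, ?_⟩
        simp only [Prod.le_def, Fin.le_def]; omega
    · left
      refine ⟨hx, ?_, ?_, ?_⟩
      · by_cases i = 0
        · left; assumption
        · right; exact hb h (by omega) le_rfl le_rfl (by omega)
      · by_cases j = 0
        · left; assumption
        · right; exact hb h le_rfl (by omega) le_rfl (by omega)
      · by_cases k = 0
        · left; assumption
        · right; exact hb h le_rfl le_rfl (by omega) (by omega)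
  · rintro (⟨hx, h1, h2, h3⟩ | h | h | h)
    · refine ⟨hi, hj, hk, _, ⟨fun hm => hx ⟨hi, hj, hk, hm⟩, ?_⟩, le_rfl⟩
      rintro ⟨⟨y1, p1⟩, ⟨y2, p2⟩, ⟨y3, p3⟩⟩ hy hle
      simp only [Prod.le_def, Fin.le_def] at hle ⊢
      have hy' : ¬ NMem I y1 y2 y3 := fun ⟨_, _, _, hh⟩ => hy hh
      refine ⟨?_, ?_, ?_⟩
      · by_contra hlt
        exact hy' ((h1.resolve_left (by omega)).mono hI (by omega) (by omega) (by omega))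
      · by_contra hlt
        exact hy' ((h2.resolve_left (by omega)).mono hI (by omega) (by omega) (by omega))
      · by_contra hlt
        exact hy' ((h3.resolve_left (by omega)).mono hI (by omega) (by omega) (by omega))
    · exact h.mono (rowmo_lower I) (by omega) le_rfl le_rfl
    · exact h.mono (rowmo_lower I) le_rfl (by omega) le_rfl
    · exact h.mono (rowmo_lower I) le_rfl le_rfl (by omega)

end

lemma exists_height (c : ℕ) (P : ℕ → Prop) (hP : ∀ k, k + 1 < c → P (k+1) → P k) :
    ∃ n ≤ c, ∀ k < c, (P k ↔ k < n) := by
  induction c with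
  | zero => exact ⟨0, le_rfl, by simp⟩
  | succ c ih =>
    obtain ⟨n, hn, h⟩ := ih (fun k hk => hP k (by omega))
    by_cases hc : P c
    · refine ⟨c+1, le_rfl, fun k hk => ⟨fun _ => hk, fun _ => ?_⟩⟩
      have : ∀ d ≤ c, P (c - d) := by
        intro d
        induction d with
        | zero => intro _; exact hc
        | succ d ihd =>
          intro hd
          refine hP _ (by omega) ?_
          rw [show c - (d+1) + 1 = c - d by omega]
          exact ihd (by omega)
      have := this (c - k) (by omega)
      rwa [show c - (c - k) = k by omega] at this
    · refine ⟨n, by omega, fun k hk => ?_⟩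
      by_cases hkc : k = c
      · subst hkc
        exact ⟨fun h => absurd h hc, fun h => by omega⟩
      · exact h k (by omega)

theorem bits (a b c : ℕ) (ha : 0 < a) (hb : 0 < b) (hc : 0 < c) (hab : a * b < a + b + c - 1)
    (s : ℕ → Set (Fin a × Fin b × Fin c)) (hs : ∀ t, IsLowerSet (s t))
    (hr : ∀ t, s (t+1) = rowmo (s t)) :
    (∀ t, ¬ NMem (s (t + (a + b + c - 1))) (a-1) (b-1) 0 ↔ ¬ NMem (s t) (a-1) (b-1) 0) ∧
    (∃ t, ¬ NMem (s t) (a-1) (b-1) 0) ∧ (∃ t, ¬ ¬ NMem (s t) (a-1) (b-1) 0) := by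
  have hex : ∀ t i j, ∃ n ≤ c, ∀ k < c, (NMem (s (t + k)) i j k ↔ k < n) := by
    intro t i j
    refine exists_height c (fun k => NMem (s (t+k)) i j k) fun k hk h => ?_
    have h : NMem (s (t + k + 1)) i j (k+1) := h
    rw [hr] at h
    exact h.below le_rfl le_rfl (by omega) (by omega)
  choose g hg1 hg2 using hex
  have hgout : ∀ t i j, ¬ (i < a ∧ j < b) → g t i j = 0 := by
    intro t i j h
    by_contra h0
    obtain ⟨h1, h2, -⟩ := (hg2 t i j 0 hc).2 (by omega)
    exact h ⟨h1, h2⟩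
  have hmono : ∀ t i j i' j', i ≤ i' → j ≤ j' → g t i' j' ≤ g t i j := by
    intro t i j i' j' h1 h2
    by_contra hlt
    have := hg1 t i' j'
    have := (hg2 t i' j' (g t i j) (by omega)).2 (by omega)
    have := (hg2 t i j (g t i j) (by omega)).1 (this.mono (hs _) h1 h2 le_rfl)
    omega
  have hnext : ∀ t i j i' j', i ≤ i' → j ≤ j' → i + j < i' + j' → g (t+1) i' j' ≤ g t i j := by
    intro t i j i' j' h1 h2 h3
    by_contra hlt
    have := hg1 (t+1) i' j'
    have := (hg2 (t+1) i' j' (g t i j) (by omega)).2 (by omega)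
    rw [show t + 1 + g t i j = t + g t i j + 1 by ring, hr] at this
    have := (hg2 t i j (g t i j) (by omega)).1 (this.below h1 h2 le_rfl (by omega))
    omega
  -- membership recursion in terms of heights
  have hrec : ∀ t i j k, i < a → j < b → k < c → (k < g (t+1) i j ↔
      (¬ k < g t i j ∧ (i = 0 ∨ k < g t (i-1) j) ∧ (j = 0 ∨ k < g t i (j-1)) ∧
        (k = 0 ∨ k - 1 < g (t+1) i j)) ∨
      k < g (t+1) (i+1) j ∨ k < g (t+1) i (j+1) ∨ k + 1 < g t i j) := by
    intro t i j k hi hj hk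
    have hR := NMem.row (hs (t+k)) hi hj hk
    rw [← hr, show t + k + 1 = (t + 1) + k by ring, hg2 _ _ _ _ hk, hg2 _ _ _ _ hk,
      hg2 _ _ _ _ hk, hg2 _ _ _ _ hk, hg2 _ _ _ _ hk, hg2 _ _ _ _ hk] at hR
    have e1 : (k = 0 ∨ NMem (s (t+k)) i j (k-1)) ↔ (k = 0 ∨ k - 1 < g (t+1) i j) := by
      rcases k with _ | k
      · simp
      · rw [← hg2 _ _ _ _ (by omega)]
        simp only [Nat.add_sub_cancel]
        rw [show t + (k+1) = t + 1 + k by ring]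
    have e2 : NMem (s (t+1+k)) i j (k+1) ↔ k + 1 < g t i j := by
      by_cases hkc : k + 1 < c
      · rw [← hg2 _ _ _ _ hkc, show t + (k+1) = t + 1 + k by ring]
      · have := hg1 t i j
        constructor
        · rintro ⟨_, _, h3, _⟩; omega
        · intro; omega
    rw [e1, e2] at hR
    exact hR
  let h : ℕ → ℕ → ℕ → ℕ := fun t i j => if i = 0 ∨ j = 0 then c else g t (i-1) (j-1)
  have hin : ∀ t i j, h t (i+1) (j+1) = g t i j := by intro t i j; simp [h]
  have hr0 : ∀ t j, h t 0 j = c := by intro t j; simp [h]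
  have hc0 : ∀ t i, h t i 0 = c := by intro t i; simp [h]
  have hle : ∀ t i j, h t i j ≤ c := by
    intro t i j
    simp only [h]; split_ifs
    · exact le_rfl
    · exact hg1 _ _ _
  refine core a b c ha hb hab h (fun t => ?_) (fun t => ¬ NMem (s t) (a-1) (b-1) 0) ?_
  · refine ⟨hr0 t, hc0 t, ?_, ?_, hle t, hle _, ?_, ?_, ?_⟩
    · intro i j hi hj
      obtain ⟨i, rfl⟩ : ∃ k, i = k + 1 := ⟨i - 1, by omega⟩
      obtain ⟨j, rfl⟩ : ∃ k, j = k + 1 := ⟨j - 1, by omega⟩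
      rw [hin, hgout _ _ _ (by omega)]
    · intro i j hi hj
      obtain ⟨i, rfl⟩ : ∃ k, i = k + 1 := ⟨i - 1, by omega⟩
      obtain ⟨j, rfl⟩ : ∃ k, j = k + 1 := ⟨j - 1, by omega⟩
      rw [hin, hgout _ _ _ (by omega)]
    · intro i j hi hj
      rcases i with _ | i
      · rw [hr0]; exact hle _ _ _
      · rw [hin, hin]; exact hmono _ _ _ _ _ (by omega) le_rfl
    · intro i j hi hj
      rcases j with _ | j
      · rw [hc0]; exact hle _ _ _
      · rw [hin, hin]; exact hmono _ _ _ _ _ le_rfl (by omega)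
    · intro i j hi hj
      have f1 : h (t+1) (i+2) (j+1) = g (t+1) (i+1) j := hin _ _ _
      have f2 : h (t+1) (i+1) (j+2) = g (t+1) i (j+1) := hin _ _ _
      have f3 : ∀ k < c, (i = 0 ∨ k < g t (i-1) j) ↔ k < h t i (j+1) := by
        intro k hk
        rcases i with _ | i
        · simp [hr0, hk]
        · simp [hin]
      have f4 : ∀ k < c, (j = 0 ∨ k < g t i (j-1)) ↔ k < h t (i+1) j := by
        intro k hk
        rcases j with _ | j
        · simp [hc0, hk]
        · simp [hin]
      have R : ∀ k < c, _ := fun k hk => hrec t i j k hi hj hk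
      have m1 : g t i j ≤ h t i (j+1) := by
        rcases i with _ | i
        · rw [hr0]; exact hg1 _ _ _
        · rw [hin]; exact hmono _ _ _ _ _ (by omega) le_rfl
      have m2 : g t i j ≤ h t (i+1) j := by
        rcases j with _ | j
        · rw [hc0]; exact hg1 _ _ _
        · rw [hin]; exact hmono _ _ _ _ _ le_rfl (by omega)
      have n1 := hnext t i j (i+1) j (by omega) le_rfl (by omega)
      have n2 := hnext t i j i (j+1) le_rfl (by omega) (by omega)
      have l1 := hg1 t i j
      have l2 := hg1 (t+1) i j
      have l3 := hle t i (j+1)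
      have l4 := hle t (i+1) j
      rw [f1, f2, hin, hin]
      generalize h t i (j+1) = X at *
      generalize h t (i+1) j = Y at *
      have R' : ∀ k < c, (k < g (t+1) i j ↔
          (¬ k < g t i j ∧ k < X ∧ k < Y ∧ (k = 0 ∨ k - 1 < g (t+1) i j)) ∨
          k < g (t+1) (i+1) j ∨ k < g (t+1) i (j+1) ∨ k + 1 < g t i j) := by
        intro k hk
        rw [R k hk, f3 k hk, f4 k hk]
      clear R f3 f4 hrec hr0 hc0 hle hin f1 f2
      by_cases hA : g (t+1) (i+1) j < g t i j ∧ g (t+1) i (j+1) < g t i j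
      · left
        refine ⟨hA.1, hA.2, ?_⟩
        have r1 := R' (g t i j - 1) (by omega)
        by_cases h2 : 2 ≤ g t i j
        · have r2 := R' (g t i j - 2) (by omega)
          omega
        · omega
      · right
        refine ⟨by omega, ?_⟩
        rcases lt_trichotomy (g (t+1) i j) (min X Y) with hlt | heq | hgt
        · have r1 := R' (g (t+1) i j) (by omega)
          omega
        · exact heq
        · have r1 := R' (min X Y) (by omega)
          omega
  · intro t
    have : h t a b = g t (a-1) (b-1) := by
      rw [← hin, Nat.sub_add_cancel ha, Nat.sub_add_cancel hb]
    rw [this]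
    have := hg2 t (a-1) (b-1) 0 hc
    rw [add_zero] at this
    rw [this]; omega

/-- Theorem 3.3 (Cameron–Fon-der-Flaass): if `a + b + c - 1` is prime and
`c > ab - a - b + 1`, then the cardinality of every rowmotion orbit on
`J(𝐚 × 𝐛 × 𝐜)` (the minimal period of every order ideal) is a multiple of
`a + b + c - 1`. -/
theorem cameron_fonderflaass (a b c : ℕ) (ha : 0 < a) (hb : 0 < b) (hc : 0 < c)
    (hp : Nat.Prime (a + b + c - 1))
    (hbound : (a : ℤ) * b - a - b + 1 < (c : ℤ)) :
    ∀ I : Set (Fin a × Fin b × Fin c), IsLowerSet I →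
      (a + b + c - 1) ∣ Function.minimalPeriod rowmo I := by
  intro I hI
  by_contra hnd
  have hcop : Nat.Coprime (a + b + c - 1) (Function.minimalPeriod rowmo I) :=
    (Nat.Prime.coprime_iff_not_dvd hp).2 hnd
  have hab : a * b < a + b + c - 1 := by
    have : ((a * b : ℕ) : ℤ) < ((a + b + c - 1 : ℕ) : ℤ) := by
      rw [Nat.cast_sub (by omega)]
      push_cast
      linarith
    exact_mod_cast this
  have hs : ∀ t, IsLowerSet (rowmo^[t] I) := by
    intro t
    rcases t with _ | t
    · exact hI
    · rw [Function.iterate_succ_apply']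
      exact rowmo_lower _
  obtain ⟨h1, ⟨t1, ht1⟩, ⟨t2, ht2⟩⟩ := bits a b c ha hb hc hab (fun t => rowmo^[t] I) hs
    (fun t => Function.iterate_succ_apply' _ _ _)
  set B : ℕ → Prop := fun t => ¬ NMem (rowmo^[t] I) (a-1) (b-1) 0 with hBdef
  set q := a + b + c - 1 with hq
  set m := Function.minimalPeriod rowmo I with hm
  have p1 : Function.Periodic B q := fun t => propext (h1 t)
  have p2 : Function.Periodic B m := by
    intro t
    simp only [hBdef]
    rw [Function.iterate_add_apply, hm, Function.iterate_minimalPeriod]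
  -- Bezout
  obtain ⟨u, hu⟩ : ∃ u, (u * m) % q = 1 := by
    obtain ⟨u, -, hu⟩ := Nat.exists_mul_mod_eq_one_of_coprime hcop.symm hp.one_lt
    exact ⟨u, by rw [mul_comm]; exact hu⟩
  have p3 : ∀ t, B (t + 1) = B t := by
    intro t
    have e := Nat.div_add_mod (u * m) q
    rw [hu] at e
    have k1 : B (t + 1 + (u * m / q) * q) = B (t + 1) := by
      simpa using p1.nat_mul (u * m / q) (t + 1)
    have k2 : B (t + u * m) = B t := by
      simpa using p2.nat_mul u t
    rw [← k1, ← k2]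
    congr 1
    rw [mul_comm (u * m / q) q]
    omega
  have p4 : ∀ t, B t = B 0 := by
    intro t
    induction t with
    | zero => rfl
    | succ t ih => rw [p3, ih]
  apply ht2
  have : B t2 := by rw [p4 t2, ← p4 t1]; exact ht1
  exact this
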